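/- arXiv:1903.12000 — 7 statements merged into one kernel-verified Lean document; each statement's English description precedes it below -/
import Mathlib

section
/- Let G be an N×N complex matrix that is an orthogonal projection (Hermitian with G² = G) of rank h whose diagonal entries are all nonzero. Then there exist nonzero vectors e_1,…,e_N ∈ ℂ^h such that ∑_{i=1}^N |e_i⟩⟨e_i| = 1 on ℂ^h and ⟨e_i, e_j⟩ = G_{ij} for all i, j; that is, G is the Gram matrix of a rank-one observable in ℂ^h. -/
open Matrix

/-- A nonzero eigenvalue of a Hermitian idempotent matrix equals `1`. -/
lemma Matrix.IsHermitian.eigenvalues_eq_one_of_isIdempotentElem {n : Type*} [Fintype n]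
    [DecidableEq n] {A : Matrix n n ℂ} (hA : A.IsHermitian) (hA2 : IsIdempotentElem A) {i : n}
    (hi : hA.eigenvalues i ≠ 0) : hA.eigenvalues i = 1 := by
  have h := hA2.spectrum_subset ℝ (hA.eigenvalues_mem_spectrum_real i)
  simpa [hi] using h

/-- Every entry of a Hermitian matrix is a sum over the eigenvectors of nonzero eigenvalue. -/
lemma Matrix.IsHermitian.apply_eq_sum_eigenvalues_ne_zero {n : Type*} [Fintype n]
    [DecidableEq n] {A : Matrix n n ℂ} (hA : A.IsHermitian) (i j : n) :
    A i j = ∑ k : {k // hA.eigenvalues k ≠ 0},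
      (hA.eigenvalues k : ℂ) * hA.eigenvectorBasis k i * star (hA.eigenvectorBasis k j) := by
  have h := congrFun (congrFun hA.spectral_theorem i) j
  rw [Unitary.conjStarAlgAut_apply, mul_apply] at h
  simp only [mul_diagonal, star_apply, IsHermitian.eigenvectorUnitary_apply,
    Function.comp_apply] at h
  rw [h, ← Finset.sum_subtype (Finset.univ.filter fun k ↦ hA.eigenvalues k ≠ 0) (by simp)
    fun k ↦ (hA.eigenvalues k : ℂ) * hA.eigenvectorBasis k i * star (hA.eigenvectorBasis k j),
    Finset.sum_filter_of_ne (by aesop)]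
  exact Finset.sum_congr rfl fun k _ ↦ by simp [mul_comm]

/-- Every rank-`h` orthogonal projection in `ℂ^N` with nonvanishing diagonal entries is the
Gram matrix of some rank-one observable in `ℂ^h`. -/
theorem stmt_2 {N h : ℕ} (G : Matrix (Fin N) (Fin N) ℂ)
    (hGh : G.IsHermitian) (hG2 : G * G = G) (hGrank : G.rank = h)
    (hGd : ∀ i, G i i ≠ 0) :
    ∃ e : Fin N → Fin h → ℂ,
      (∀ i, e i ≠ 0) ∧
      (∑ i, vecMulVec (e i) (star (e i)) = 1) ∧
      ∀ i j, star (e i) ⬝ᵥ e j = G i j := by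
  have hcard : Fintype.card {k // hGh.eigenvalues k ≠ 0} = h := by
    rw [← hGh.rank_eq_card_non_zero_eigs, hGrank]
  let σ : Fin h ≃ {k // hGh.eigenvalues k ≠ 0} := (Fintype.equivFinOfCardEq hcard).symm
  let e : Fin N → Fin h → ℂ := fun i k ↦ star (hGh.eigenvectorBasis (σ k) i)
  have hgram : ∀ i j, star (e i) ⬝ᵥ e j = G i j := fun i j ↦ by
    rw [hGh.apply_eq_sum_eigenvalues_ne_zero, ← σ.sum_comp, dotProduct]
    refine Finset.sum_congr rfl fun k _ ↦ ?_
    simp [e, hGh.eigenvalues_eq_one_of_isIdempotentElem hG2 (σ k).2]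
  refine ⟨e, fun i hi ↦ hGd i ?_, ?_, hgram⟩
  · rw [← hgram, hi, dotProduct_zero]
  · ext k l
    have h := orthonormal_iff_ite.mp hGh.eigenvectorBasis.orthonormal (σ k) (σ l)
    rw [EuclideanSpace.inner_eq_star_dotProduct, dotProduct] at h
    simp only [Subtype.val_inj, σ.injective.eq_iff] at h
    rw [Matrix.sum_apply, one_apply, ← h]
    refine Finset.sum_congr rfl fun i _ ↦ ?_
    simp [e, vecMulVec_apply, mul_comm]
end

section
/- Let H_1,…,H_N be an independent family of subspaces of a finite-dimensional complex Hilbert space H with dim H = h and dim H_i = h_i. Then h_i + h_j ≤ h for all 1 ≤ i < j ≤ N. -/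
/-- A family of subspaces of a Hilbert space `H` is independent if the subspaces span `H` and
any family of operators `X i` with `ran (X i) ⊆ V i` summing to zero must vanish. -/
def IndepFamily {H : Type*} [NormedAddCommGroup H] [InnerProductSpace ℂ H]
    {N : ℕ} (V : Fin N → Submodule ℂ H) : Prop :=
  (⨆ i, V i) = ⊤ ∧
    ∀ X : Fin N → (H →ₗ[ℂ] H), (∀ i, LinearMap.range (X i) ≤ V i) →
      ∑ i, X i = 0 → ∀ i, X i = 0

/-- Two distinct members of an independent family of subspaces intersect trivially. -/
theorem IndepFamily.disjoint {H : Type*} [NormedAddCommGroup H] [InnerProductSpace ℂ H]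
    [FiniteDimensional ℂ H] {N : ℕ} {V : Fin N → Submodule ℂ H}
    (hV : IndepFamily V) {i j : Fin N} (hij : i ≠ j) : Disjoint (V i) (V j) := by
  rw [Submodule.disjoint_def]
  intro x hxi hxj
  let P : H →ₗ[ℂ] H := ((V i ⊓ V j).starProjection : H →L[ℂ] H)
  have hP : ∀ y, P y ∈ V i ⊓ V j := fun y => Submodule.starProjection_apply_mem _ y
  have hX := hV.2 (Pi.single i P - Pi.single j P) ?_ (by simp [Finset.sum_sub_distrib]) i
  · have hPx : P x = x :=
      Submodule.starProjection_eq_self_iff.mpr (Submodule.mem_inf.mpr ⟨hxi, hxj⟩)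
    have hP0 : P = 0 := by simpa [hij] using hX
    rw [← hPx, hP0, LinearMap.zero_apply]
  · rintro k _ ⟨y, rfl⟩
    rw [Pi.sub_apply, LinearMap.sub_apply]
    refine sub_mem ?_ ?_
    · rcases eq_or_ne k i with rfl | hk
      · simpa using (hP y).1
      · simp [hk]
    · rcases eq_or_ne k j with rfl | hk
      · simpa using (hP y).2
      · simp [hk]

/-- For an independent family of subspaces of a finite-dimensional complex Hilbert space,
the dimensions of any two distinct members sum to at most the dimension of the whole space. -/
theorem stmt_6 {H : Type*} [NormedAddCommGroup H] [InnerProductSpace ℂ H]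
    [FiniteDimensional ℂ H] {N : ℕ} (V : Fin N → Submodule ℂ H)
    (hV : IndepFamily V) (i j : Fin N) (hij : i < j) :
    Module.finrank ℂ (V i) + Module.finrank ℂ (V j) ≤ Module.finrank ℂ H := by
  exact Submodule.finrank_add_finrank_le_of_disjoint (hV.disjoint hij.ne)
end

section
/- Let A = (A_1,…,A_N) be an N-valued observable in ℂ^h, let d_i = rank A_i, and for each i let (|iμ⟩)_{μ=1,…,d_i} be a basis of ran A_i. Let H be the D×D matrix (D = ∑_i d_i²), indexed by triples (i,μ,ν) with 1 ≤ μ,ν ≤ d_i, with entries H_{(i,μ,ν),(j,κ,λ)} = ⟨iμ | jκ⟩ · conj(⟨iν | jλ⟩). Then A is extremal if and only if H is invertible. -/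
open Matrix
open scoped ComplexOrder

/-- An `ι`-valued observable in `ℂ^n`: a family of positive semidefinite matrices
summing to the identity. -/
def IsObservable {ι n : Type*} [Fintype ι] [Fintype n] [DecidableEq n]
    (A : ι → Matrix n n ℂ) : Prop :=
  (∀ i, (A i).PosSemidef) ∧ ∑ i, A i = 1

/-- An observable is extremal if it is an extreme point of the convex set of observables. -/
def IsExtremalObservable {ι n : Type*} [Fintype ι] [Fintype n] [DecidableEq n]
    (A : ι → Matrix n n ℂ) : Prop :=
  A ∈ Set.extremePoints ℝ {B : ι → Matrix n n ℂ | IsObservable B}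

open scoped Topology in
/-- A small Hermitian perturbation of the identity is positive semidefinite. -/
theorem Matrix.IsHermitian.eventually_posSemidef_one_add_smul {n : Type*} [Fintype n]
    [DecidableEq n] {K : Matrix n n ℂ} (hK : K.IsHermitian) :
    ∀ᶠ t : ℝ in 𝓝 0, (1 + t • K).PosSemidef := by
  have hev : ∀ᶠ t : ℝ in 𝓝 0, ∀ i, 0 < 1 + t * hK.eigenvalues i := by
    refine Filter.eventually_all.2 fun i => ?_
    have hc : Continuous fun t : ℝ => 1 + t * hK.eigenvalues i := by fun_prop
    exact hc.continuousAt.eventually (lt_mem_nhds (by simp))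
  filter_upwards [hev] with t ht
  have hdiag : (Matrix.diagonal fun i => ((1 + t * hK.eigenvalues i : ℝ) : ℂ)).PosSemidef :=
    Matrix.PosSemidef.diagonal fun i => by simpa using mod_cast (ht i).le
  have hdecomp : (Matrix.diagonal fun i => ((1 + t * hK.eigenvalues i : ℝ) : ℂ)) =
      1 + (t : ℂ) • Matrix.diagonal (RCLike.ofReal ∘ hK.eigenvalues) := by
    ext i j
    rcases eq_or_ne i j with rfl | hij
    · simp
    · simp [hij]
  have hconj := hdiag.mul_mul_conjTranspose_same (hK.eigenvectorUnitary : Matrix n n ℂ)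
  have hU : (hK.eigenvectorUnitary : Matrix n n ℂ) * (hK.eigenvectorUnitary : Matrix n n ℂ)ᴴ = 1 :=
    (Matrix.mem_unitaryGroup_iff).1 hK.eigenvectorUnitary.2
  have hspec := hK.spectral_theorem
  rw [Unitary.conjStarAlgAut_apply, Matrix.star_eq_conjTranspose] at hspec
  rw [hdecomp, Matrix.mul_add, Matrix.add_mul, Matrix.mul_one, hU, Matrix.mul_smul,
    Matrix.smul_mul, ← hspec] at hconj
  simpa using hconj

open scoped Topology MatrixOrder in
/-- A positive semidefinite matrix stays so under small perturbations `t • (A * Y * A)`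
with `Y` Hermitian. -/
theorem Matrix.PosSemidef.eventually_posSemidef_add_smul {n : Type*} [Fintype n] [DecidableEq n]
    {A Y : Matrix n n ℂ} (hA : A.PosSemidef) (hY : Y.IsHermitian) :
    ∀ᶠ t : ℝ in 𝓝 0, (A + t • (A * Y * A)).PosSemidef := by
  obtain ⟨B, rfl⟩ := CStarAlgebra.nonneg_iff_eq_star_mul_self.mp hA.nonneg
  rw [Matrix.star_eq_conjTranspose]
  filter_upwards [(Matrix.isHermitian_mul_mul_conjTranspose B hY).eventually_posSemidef_one_add_smul]
    with t ht
  convert ht.conjTranspose_mul_mul_same B using 1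
  simp only [Matrix.mul_add, Matrix.add_mul, Matrix.mul_one, Matrix.mul_smul, Matrix.smul_mul,
    Matrix.mul_assoc]

open scoped Topology in
theorem IsExtremalObservable.eq_zero_of_isHermitian {ι n : Type*} [Fintype ι] [Fintype n]
    [DecidableEq n] {A Y : ι → Matrix n n ℂ} (hA : IsExtremalObservable A)
    (hY : ∀ i, (Y i).IsHermitian) (hsum : ∑ i, A i * Y i * A i = 0) (i : ι) :
    A i * Y i * A i = 0 := by
  have hev : ∀ᶠ t : ℝ in 𝓝 0, ∀ i, (A i + t • (A i * Y i * A i)).PosSemidef :=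
    Filter.eventually_all.2 fun i => (hA.1.1 i).eventually_posSemidef_add_smul (hY i)
  have hneg : ∀ᶠ t : ℝ in 𝓝 0, ∀ i, (A i + (-t) • (A i * Y i * A i)).PosSemidef :=
    (show Filter.Tendsto (fun t : ℝ => -t) (𝓝 0) (𝓝 0) by
      simpa using (continuous_neg (G := ℝ)).tendsto 0).eventually hev
  obtain ⟨t, ⟨hpos, hneg⟩, ht⟩ :=
    (((hev.and hneg).filter_mono nhdsWithin_le_nhds).and
      (self_mem_nhdsWithin : Set.Ioi (0 : ℝ) ∈ 𝓝[>] 0)).exists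
  have hobs (s : ℝ) (hs : ∀ i, (A i + s • (A i * Y i * A i)).PosSemidef) :
      IsObservable fun i => A i + s • (A i * Y i * A i) :=
    ⟨hs, by rw [Finset.sum_add_distrib, ← Finset.smul_sum, hsum, smul_zero, add_zero, hA.1.2]⟩
  have hseg : A ∈ openSegment ℝ (fun i => A i + t • (A i * Y i * A i))
      (fun i => A i + (-t) • (A i * Y i * A i)) := by
    refine ⟨1 / 2, 1 / 2, by norm_num, by norm_num, by norm_num, ?_⟩
    funext j
    simp only [Pi.add_apply, Pi.smul_apply]
    module
  have heq := congrFun (hA.2 (hobs t hpos) (hobs (-t) hneg) hseg) i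
  exact (smul_eq_zero.1 (add_eq_left.1 heq)).resolve_left (ne_of_gt ht)

theorem IsExtremalObservable.eq_zero_of_sum_eq_zero {ι n : Type*} [Fintype ι] [Fintype n]
    [DecidableEq n] {A Y : ι → Matrix n n ℂ} (hA : IsExtremalObservable A)
    (hsum : ∑ i, A i * Y i * A i = 0) (i : ι) : A i * Y i * A i = 0 := by
  have hstar : ∑ i, A i * (Y i)ᴴ * A i = 0 := by
    have := congrArg Matrix.conjTranspose hsum
    simpa only [Matrix.conjTranspose_sum, Matrix.conjTranspose_mul, (hA.1.1 _).1.eq,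
      Matrix.conjTranspose_zero, ← Matrix.mul_assoc] using this
  have hre := hA.eq_zero_of_isHermitian (Y := fun i => Y i + (Y i)ᴴ)
    (fun i => Matrix.isHermitian_add_transpose_self _)
    (by simp [Matrix.mul_add, Matrix.add_mul, Finset.sum_add_distrib, hsum, hstar]) i
  have him := hA.eq_zero_of_isHermitian (Y := fun i => Complex.I • (Y i - (Y i)ᴴ))
    (fun i => by
      simp only [Matrix.IsHermitian, Matrix.conjTranspose_smul, Matrix.conjTranspose_sub,
        Matrix.conjTranspose_conjTranspose, Complex.star_def, Complex.conj_I]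
      module)
    (by simp [Matrix.mul_sub, Matrix.sub_mul, ← Finset.smul_sum, hsum, hstar]) i
  simp only [Matrix.mul_smul, Matrix.smul_mul, smul_eq_zero, Complex.I_ne_zero, false_or,
    Matrix.mul_sub, Matrix.sub_mul] at him
  rw [Matrix.mul_add, Matrix.add_mul, ← sub_eq_zero.1 him] at hre
  rw [← two_smul ℂ] at hre
  exact (smul_eq_zero.1 hre).resolve_left two_ne_zero

/-- A matrix whose kernel contains that of `A` is a left multiple of `A`. -/
theorem Matrix.exists_eq_mul_of_mulVec_eq_zero {K m n l : Type*} [Field K] [Fintype m] [Fintype n]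
    {A : Matrix m n K} {B : Matrix l n K} (hker : ∀ x, A *ᵥ x = 0 → B *ᵥ x = 0) :
    ∃ Z : Matrix l m K, B = Z * A := by
  classical
  have hrow (r : l) : ∃ z : m → K, B r = z ᵥ* A := by
    have hmem : (LinearMap.proj r ∘ₗ B.mulVecLin : (n → K) →ₗ[K] K) ∈
        Submodule.span K (Set.range fun s => (LinearMap.proj s ∘ₗ A.mulVecLin)) := by
      refine mem_span_of_iInf_ker_le_ker fun x hx => ?_
      simp only [Submodule.mem_iInf, LinearMap.mem_ker, LinearMap.comp_apply,
        LinearMap.proj_apply, Matrix.mulVecLin_apply] at hx ⊢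
      exact congrFun (hker x (funext hx)) r
    obtain ⟨z, hz⟩ := (Submodule.mem_span_range_iff_exists_fun K).1 hmem
    refine ⟨z, funext fun c => ?_⟩
    have := LinearMap.congr_fun hz (Pi.single c 1)
    simpa [Matrix.vecMul, dotProduct, LinearMap.sum_apply] using this.symm
  choose Z hZ using hrow
  exact ⟨Matrix.of Z, funext fun r => by rw [hZ r]; rfl⟩

theorem Matrix.exists_eq_mul_of_col_mem_range {K m n l : Type*} [Field K] [Fintype n]
    {A : Matrix m n K} {B : Matrix m l K}
    (hcol : ∀ j, B.col j ∈ LinearMap.range A.mulVecLin) : ∃ Z : Matrix n l K, B = A * Z := by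
  choose z hz using hcol
  exact ⟨Matrix.of fun r j => z j r, Matrix.ext fun r j => (congrFun (hz j) r).symm⟩

theorem Matrix.exists_mul_eq_one_of_linearIndependent_col {K m n : Type*} [Field K] [Fintype m]
    [Fintype n] [DecidableEq n] {V : Matrix m n K} (hV : LinearIndependent K V.col) :
    ∃ L : Matrix n m K, L * V = 1 := by
  obtain ⟨L, hL⟩ := Matrix.exists_eq_mul_of_mulVec_eq_zero (A := V) (B := (1 : Matrix n n K))
    fun x hx => by
      rw [Matrix.one_mulVec]
      exact Matrix.mulVec_injective_iff.2 hV (by simpa using hx)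
  exact ⟨L, hL.symm⟩

/-- A Hermitian matrix whose kernel contains that of `A` is of the form `V * M * Vᴴ` when the
columns of `V` form a basis of the range of `A`. -/
theorem Matrix.IsHermitian.exists_eq_mul_mul_conjTranspose {m n : Type*} [Fintype m] [Fintype n]
    {A B : Matrix n n ℂ} {V : Matrix n m ℂ} (hA : A.IsHermitian)
    (hB : B.IsHermitian) (hV : LinearIndependent ℂ V.col)
    (hspan : LinearMap.range V.mulVecLin = LinearMap.range A.mulVecLin)
    (hker : ∀ x, A *ᵥ x = 0 → B *ᵥ x = 0) : ∃ M : Matrix m m ℂ, B = V * M * Vᴴ := by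
  classical
  obtain ⟨Z, hZ⟩ := Matrix.exists_eq_mul_of_mulVec_eq_zero hker
  have hBA : B = A * Zᴴ := by
    rw [← hB.eq, hZ, Matrix.conjTranspose_mul, hA.eq]
  obtain ⟨Y, hY⟩ : ∃ Y : Matrix m n ℂ, B = V * Y := by
    refine Matrix.exists_eq_mul_of_col_mem_range fun j => ?_
    rw [hspan, hBA]
    exact ⟨Zᴴ.col j, rfl⟩
  obtain ⟨L, hL⟩ := Matrix.exists_mul_eq_one_of_linearIndependent_col hV
  have hBY : B = Yᴴ * Vᴴ := by rw [← Matrix.conjTranspose_mul, ← hY, hB.eq]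
  have hYL : Y = L * Yᴴ * Vᴴ := by
    rw [Matrix.mul_assoc, ← hBY, hY, ← Matrix.mul_assoc, hL, Matrix.one_mul]
  exact ⟨L * Yᴴ, by rw [Matrix.mul_assoc, ← hYL, hY]⟩

theorem isExtremalObservable_iff_forall_sum_eq_zero {ι n : Type*} {m : ι → Type*} [Fintype ι]
    [Fintype n] [DecidableEq n] [∀ i, Fintype (m i)] {A : ι → Matrix n n ℂ}
    (hA : IsObservable A) {V : ∀ i, Matrix n (m i) ℂ}
    (hV : ∀ i, LinearIndependent ℂ (V i).col)
    (hspan : ∀ i, LinearMap.range (V i).mulVecLin = LinearMap.range (A i).mulVecLin) :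
    IsExtremalObservable A ↔
      ∀ X : ∀ i, Matrix (m i) (m i) ℂ, ∑ i, V i * X i * (V i)ᴴ = 0 → X = 0 := by
  classical
  constructor
  · intro hext X hX
    have hZ (i : ι) : ∃ Z : Matrix n (m i) ℂ, V i = A i * Z := by
      refine Matrix.exists_eq_mul_of_col_mem_range fun j => ?_
      rw [← hspan i]
      exact ⟨Pi.single j 1, by simp⟩
    choose Z hZ using hZ
    have hconj (i : ι) : V i * X i * (V i)ᴴ = A i * (Z i * X i * (Z i)ᴴ) * A i := by
      rw [hZ i, Matrix.conjTranspose_mul, (hA.1 i).1.eq]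
      simp only [Matrix.mul_assoc]
    simp only [hconj] at hX
    funext i
    have hzero := hext.eq_zero_of_sum_eq_zero hX i
    rw [← hconj] at hzero
    obtain ⟨L, hL⟩ := Matrix.exists_mul_eq_one_of_linearIndependent_col (hV i)
    have hL' : (V i)ᴴ * Lᴴ = 1 := by
      rw [← Matrix.conjTranspose_mul, hL, Matrix.conjTranspose_one]
    calc X i = (L * V i) * X i * ((V i)ᴴ * Lᴴ) := by rw [hL, hL', Matrix.one_mul, Matrix.mul_one]
      _ = L * (V i * X i * (V i)ᴴ) * Lᴴ := by simp only [Matrix.mul_assoc]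
      _ = 0 := by rw [hzero, Matrix.mul_zero, Matrix.zero_mul]
  · intro hinj
    refine ⟨hA, fun B hB C hC hseg => ?_⟩
    obtain ⟨a, b, ha, hb, -, habA⟩ := hseg
    have hker (i : ι) (x : n → ℂ) (hx : A i *ᵥ x = 0) : B i *ᵥ x = 0 := by
      rw [← (hB.1 i).dotProduct_mulVec_zero_iff]
      have hAi : A i = a • B i + b • C i := (congrFun habA i).symm
      have hquad : a • (star x ⬝ᵥ B i *ᵥ x) + b • (star x ⬝ᵥ C i *ᵥ x) = 0 := by
        rw [← dotProduct_smul, ← dotProduct_smul, ← dotProduct_add, ← Matrix.smul_mulVec,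
          ← Matrix.smul_mulVec, ← Matrix.add_mulVec, ← hAi, hx, dotProduct_zero]
      have hBx := smul_nonneg ha.le ((hB.1 i).dotProduct_mulVec_nonneg x)
      have hCx := smul_nonneg hb.le ((hC.1 i).dotProduct_mulVec_nonneg x)
      exact (smul_eq_zero.1 ((add_eq_zero_iff_of_nonneg hBx hCx).1 hquad).1).resolve_left ha.ne'
    choose M hM using fun i => (hA.1 i).1.exists_eq_mul_mul_conjTranspose (hA.1 i).1 (hV i)
      (hspan i) fun _ hx => hx
    choose M' hM' using fun i => (hA.1 i).1.exists_eq_mul_mul_conjTranspose (hB.1 i).1 (hV i)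
      (hspan i) (hker i)
    have hzero := hinj (M' - M) (by
      simp only [Pi.sub_apply, Matrix.mul_sub, Matrix.sub_mul, ← hM, ← hM',
        Finset.sum_sub_distrib, hA.2, hB.2, sub_self])
    funext i
    rw [hM i, hM' i, sub_eq_zero.1 hzero]

/-- The Gram matrix of the operators `|iμ⟩⟨iν|` is invertible iff these operators are linearly
independent. -/
theorem isUnit_gram_iff_forall_sum_eq_zero {ι n : Type*} {m : ι → Type*} [Fintype ι]
    [DecidableEq ι] [Fintype n] [∀ i, Fintype (m i)] [∀ i, DecidableEq (m i)]
    (v : ∀ i, m i → n → ℂ) :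
    IsUnit (Matrix.of (fun p q : (i : ι) × (m i × m i) =>
        (star (v p.1 p.2.1) ⬝ᵥ v q.1 q.2.1) * star (star (v p.1 p.2.2) ⬝ᵥ v q.1 q.2.2))) ↔
      ∀ X : ∀ i, Matrix (m i) (m i) ℂ,
        ∑ i, (Matrix.of (v i))ᵀ * X i * ((Matrix.of (v i))ᵀ)ᴴ = 0 → X = 0 := by
  let W : Matrix (n × n) ((i : ι) × (m i × m i)) ℂ :=
    Matrix.of fun a p => v p.1 p.2.1 a.1 * star (v p.1 p.2.2 a.2)
  have hgram : Matrix.of (fun p q : (i : ι) × (m i × m i) =>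
      (star (v p.1 p.2.1) ⬝ᵥ v q.1 q.2.1) * star (star (v p.1 p.2.2) ⬝ᵥ v q.1 q.2.2)) =
      Wᴴ * W := by
    ext p q
    simp only [Matrix.of_apply, Matrix.mul_apply, Matrix.conjTranspose_apply, dotProduct,
      Pi.star_apply, star_sum, star_mul', star_star, Fintype.sum_prod_type, Finset.sum_mul_sum, W]
    exact Finset.sum_congr rfl fun a _ => Finset.sum_congr rfl fun b _ => by ring
  have hW (x : (i : ι) × (m i × m i) → ℂ) (a b : n) : (W *ᵥ x) (a, b) =
      (∑ i, (Matrix.of (v i))ᵀ * Matrix.of (fun μ ν => x ⟨i, μ, ν⟩) * ((Matrix.of (v i))ᵀ)ᴴ) a b := by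
    simp only [Matrix.mulVec, dotProduct, Fintype.sum_sigma, Fintype.sum_prod_type,
      Matrix.sum_apply, Matrix.mul_apply, Matrix.of_apply, Matrix.transpose_apply,
      Matrix.conjTranspose_apply, Finset.sum_mul, W]
    refine Finset.sum_congr rfl fun i _ => ?_
    rw [Finset.sum_comm]
    exact Finset.sum_congr rfl fun ν _ => Finset.sum_congr rfl fun μ _ => by ring
  rw [hgram, ← Matrix.mulVec_injective_iff_isUnit, ← Matrix.coe_mulVecLin,
    ← LinearMap.ker_eq_bot, Matrix.ker_mulVecLin_conjTranspose_mul_self, LinearMap.ker_eq_bot']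
  constructor
  · intro hinj X hX
    have hx := hinj (fun p => X p.1 p.2.1 p.2.2) (funext fun ⟨a, b⟩ => by
      rw [Matrix.mulVecLin_apply, hW]
      exact congrFun (congrFun hX a) b)
    funext i
    ext μ ν
    exact congrFun hx ⟨i, μ, ν⟩
  · intro hinj x hx
    have hX := hinj (fun i => Matrix.of fun μ ν => x ⟨i, μ, ν⟩) (by
      ext a b
      rw [← hW, ← Matrix.mulVecLin_apply, hx]
      rfl)
    funext ⟨i, μ, ν⟩
    exact congrFun (congrFun (congrFun hX i) μ) ν

/-- An observable is extremal iff its super Gram matrix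
`H_{(i,μ,ν),(j,κ,λ)} = ⟨iμ|jκ⟩ ⋅ conj ⟨iν|jλ⟩`, built from bases of the ranges of the
components, is invertible. -/
theorem stmt_10 {N h : ℕ} (A : Fin N → Matrix (Fin h) (Fin h) ℂ)
    (hA : IsObservable A) (d : Fin N → ℕ) (hd : ∀ i, d i = (A i).rank)
    (v : (i : Fin N) → Fin (d i) → (Fin h → ℂ))
    (hbasis : ∀ i, LinearIndependent ℂ (v i) ∧
      Submodule.span ℂ (Set.range (v i)) = LinearMap.range (A i).mulVecLin) :
    IsExtremalObservable A ↔
      IsUnit (Matrix.of (fun p q : (i : Fin N) × (Fin (d i) × Fin (d i)) =>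
        (star (v p.1 p.2.1) ⬝ᵥ v q.1 q.2.1) * star (star (v p.1 p.2.2) ⬝ᵥ v q.1 q.2.2))) := by
  rw [isUnit_gram_iff_forall_sum_eq_zero]
  refine isExtremalObservable_iff_forall_sum_eq_zero hA (fun i => (hbasis i).1) fun i => ?_
  rw [Matrix.range_mulVecLin]
  exact (hbasis i).2
end

section
/- Let A = (|e_1⟩⟨e_1|,…,|e_N⟩⟨e_N|) be a rank-one observable in ℂ^h with Gram matrix G (G_{ij} = ⟨e_i, e_j⟩). Then A is extremal if and only if the N×N matrix H with entries H_{ij} = |G_{ij}|² is invertible. -/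
open Matrix
open scoped ComplexOrder

/-- A positive semidefinite matrix dominated by the rank-one matrix `|e⟩⟨e|` is a multiple of it. -/
theorem Matrix.PosSemidef.exists_eq_smul_vecMulVec {n : Type*} [Fintype n]
    {M : Matrix n n ℂ} {e : n → ℂ} (he : e ≠ 0) (hM : M.PosSemidef)
    (hle : (vecMulVec e (star e) - M).PosSemidef) :
    ∃ t : ℂ, M = t • vecMulVec e (star e) := by
  classical
  have hc : star e ⬝ᵥ e ≠ 0 := by simpa [dotProduct_star_self_eq_zero] using he
  have hker : ∀ x, star e ⬝ᵥ x = 0 → M *ᵥ x = 0 := by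
    intro x hx
    have h := hle.dotProduct_mulVec_nonneg x
    rw [sub_mulVec, vecMulVec_mulVec, hx, dotProduct_sub] at h
    simp only [MulOpposite.op_zero, zero_smul, dotProduct_zero, zero_sub, neg_nonneg] at h
    exact (hM.dotProduct_mulVec_zero_iff x).1 (le_antisymm h (hM.dotProduct_mulVec_nonneg x))
  have happly : ∀ y, M *ᵥ y = ((star e ⬝ᵥ y) / (star e ⬝ᵥ e)) • M *ᵥ e := by
    intro y
    have h := hker (y - ((star e ⬝ᵥ y) / (star e ⬝ᵥ e)) • e) (by
      rw [dotProduct_sub, dotProduct_smul, smul_eq_mul, div_mul_cancel₀ _ hc, sub_self])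
    rwa [mulVec_sub, mulVec_smul, sub_eq_zero] at h
  have hcol : M = vecMulVec ((star e ⬝ᵥ e)⁻¹ • M *ᵥ e) (star e) := by
    refine ext_of_mulVec_single fun j => ?_
    rw [happly, vecMulVec_mulVec, op_smul_eq_smul, smul_smul, div_eq_mul_inv]
  obtain ⟨u, hu⟩ : ∃ u, M = vecMulVec u (star e) := ⟨_, hcol⟩
  have hrow : M = vecMulVec e (star u) := by
    rw [← hM.isHermitian.eq, hu, conjTranspose_vecMulVec, star_star]
  refine ⟨(star e ⬝ᵥ e)⁻¹ * (star u ⬝ᵥ e), ?_⟩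
  have hMe : M *ᵥ e = (star u ⬝ᵥ e) • e := by
    rw [hrow, vecMulVec_mulVec, op_smul_eq_smul]
  rw [hcol, hMe, smul_smul, smul_vecMulVec]

/-- The rank-one matrices `|e i⟩⟨e i|` are linearly independent iff their Hilbert–Schmidt Gram
matrix is invertible. -/
theorem isUnit_normSq_gram_iff {ι n : Type*} [Fintype ι] [DecidableEq ι] [Fintype n]
    (e : ι → n → ℂ) (G : Matrix ι ι ℂ) (hG : ∀ i j, G i j = star (e i) ⬝ᵥ e j) :
    IsUnit (Matrix.of (fun i j => G i j * star (G i j))) ↔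
      LinearIndependent ℂ (fun i => vecMulVec (e i) (star (e i))) := by
  have htrace : ∀ (v : ι → ℂ) (i : ι),
      (Matrix.of (fun i j => G i j * star (G i j)) *ᵥ v) i =
        (vecMulVec (e i) (star (e i)) * ∑ j, v j • vecMulVec (e j) (star (e j))).trace := by
    intro v i
    rw [Finset.mul_sum, trace_sum]
    refine Finset.sum_congr rfl fun j _ => ?_
    have hstar : star (G i j) = e i ⬝ᵥ star (e j) := by
      rw [hG, star_dotProduct, star_star, dotProduct_comm]
    change G i j * star (G i j) * v j = _
    rw [Matrix.mul_smul, trace_smul, vecMulVec_mul_vecMulVec, trace_vecMulVec, dotProduct_smul,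
      hstar, ← hG, smul_eq_mul, smul_eq_mul, mul_comm (v j)]
  rw [← mulVec_injective_iff_isUnit, Fintype.linearIndependent_iff]
  constructor
  · intro hinj v hv i
    have h0 : v = 0 := hinj (by
      ext i
      rw [htrace, hv, mulVec_zero]
      simp)
    rw [h0, Pi.zero_apply]
  · intro hli
    refine (injective_iff_map_eq_zero (Matrix.mulVecLin _)).2 fun v hv => ?_
    rw [mulVecLin_apply] at hv
    refine funext (hli v (trace_conjTranspose_mul_self_eq_zero_iff.1 ?_))
    rw [conjTranspose_sum, Finset.sum_mul, trace_sum]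
    refine Finset.sum_eq_zero fun i _ => ?_
    rw [conjTranspose_smul, conjTranspose_vecMulVec, star_star, smul_mul, trace_smul, ← htrace, hv,
      Pi.zero_apply, smul_zero]

/-- A rank-one observable with linearly independent effects is extremal. -/
theorem isExtremalObservable_of_linearIndependent {ι n : Type*} [Fintype ι] [Fintype n]
    [DecidableEq n] (e : ι → n → ℂ) (he0 : ∀ i, e i ≠ 0)
    (he : ∑ i, vecMulVec (e i) (star (e i)) = 1)
    (hli : LinearIndependent ℂ (fun i => vecMulVec (e i) (star (e i)))) :
    IsExtremalObservable (fun i => vecMulVec (e i) (star (e i))) := by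
  refine ⟨⟨fun i => posSemidef_vecMulVec_self_star _, he⟩, ?_⟩
  rintro B hB C hC ⟨a, b, ha, hb, -, hBC⟩
  have hmul : ∀ i, ∃ t : ℂ, B i = t • vecMulVec (e i) (star (e i)) := by
    intro i
    have hi : a • B i + b • C i = vecMulVec (e i) (star (e i)) := congrFun hBC i
    obtain ⟨t, ht⟩ := ((hB.1 i).smul ha.le).exists_eq_smul_vecMulVec (he0 i) (by
      rw [← hi, add_sub_cancel_left]
      exact (hC.1 i).smul hb.le)
    refine ⟨(a⁻¹ : ℝ) • t, ?_⟩
    rw [smul_assoc, ← ht, inv_smul_smul₀ ha.ne']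
  choose t ht using hmul
  have hsum : ∑ i, (t i - 1) • vecMulVec (e i) (star (e i)) = 0 := by
    simp only [sub_smul, one_smul, Finset.sum_sub_distrib, ← ht, he, hB.2, sub_self]
  funext i
  rw [ht, sub_eq_zero.1 (Fintype.linearIndependent_iff.1 hli _ hsum i), one_smul]

/-- The effects of an extremal observable without zero effects satisfy no nontrivial real linear
relation. -/
theorem IsExtremalObservable.eq_zero_of_sum_smul_eq_zero {ι n : Type*} [Fintype ι] [Fintype n]
    [DecidableEq n] {A : ι → Matrix n n ℂ} (hA : IsExtremalObservable A) (hA0 : ∀ i, A i ≠ 0)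
    (w : ι → ℝ) (hw : ∑ i, w i • A i = 0) (i : ι) : w i = 0 := by
  obtain ⟨hobs, hext⟩ := hA
  obtain ⟨ε, hε, hεw⟩ : ∃ ε : ℝ, 0 < ε ∧ ∀ i, |ε * w i| ≤ 1 := by
    have hpos : 0 < 1 + ∑ j, |w j| := by positivity
    refine ⟨(1 + ∑ j, |w j|)⁻¹, inv_pos.2 hpos, fun i => ?_⟩
    rw [abs_mul, abs_of_pos (inv_pos.2 hpos), inv_mul_le_one₀ hpos]
    linarith [Finset.single_le_sum (fun j _ => abs_nonneg (w j)) (Finset.mem_univ i)]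
  have hperturb : ∀ s : ℝ, |s| = 1 → IsObservable (fun i => (1 + s * (ε * w i)) • A i) := by
    refine fun s hs => ⟨fun i => (hobs.1 i).smul ?_, ?_⟩
    · have h : |s * (ε * w i)| ≤ 1 := by rw [abs_mul, hs, one_mul]; exact hεw i
      linarith [(abs_le.1 h).1]
    · simp only [add_smul, one_smul, mul_smul, Finset.sum_add_distrib, ← Finset.smul_sum, hw,
        smul_zero, add_zero, hobs.2]
  have heq := congrFun (hext (hperturb 1 (by simp)) (hperturb (-1) (by simp))
    ⟨1 / 2, 1 / 2, by norm_num, by norm_num, by norm_num, by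
      funext j
      simp only [Pi.add_apply, Pi.smul_apply, smul_smul, ← add_smul]
      rw [show (1 / 2 * (1 + 1 * (ε * w j)) + 1 / 2 * (1 + -1 * (ε * w j)) : ℝ) = 1 by ring,
        one_smul]⟩) i
  simp only [add_smul, one_smul, one_mul, add_eq_left] at heq
  have hprod : ε * w i = 0 := (smul_eq_zero.1 heq).resolve_right (hA0 i)
  exact (mul_eq_zero.1 hprod).resolve_left (ne_of_gt hε)

/-- The effects of an extremal observable without zero effects are linearly independent. -/
theorem IsExtremalObservable.linearIndependent {ι n : Type*} [Fintype ι] [Fintype n]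
    [DecidableEq n] {A : ι → Matrix n n ℂ} (hA : IsExtremalObservable A)
    (hA0 : ∀ i, A i ≠ 0) : LinearIndependent ℂ A := by
  refine Fintype.linearIndependent_iff.2 fun v hv => ?_
  have hstar : ∑ i, star (v i) • A i = 0 := by
    have h := congrArg conjTranspose hv
    simpa only [conjTranspose_sum, conjTranspose_smul, (hA.1.1 _).isHermitian.eq,
      conjTranspose_zero] using h
  have hre : ∑ i, (v i).re • A i = 0 := by
    have h : ∀ i, (v i).re • A i = (1 / 2 : ℂ) • (v i • A i + star (v i) • A i) := by
      intro i
      rw [← add_smul, smul_smul, ← Complex.coe_smul, Complex.re_eq_add_conj, Complex.star_def]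
      congr 1
      ring
    simp only [h, ← Finset.smul_sum, Finset.sum_add_distrib, hv, hstar, add_zero, smul_zero]
  have him : ∑ i, (v i).im • A i = 0 := by
    have h : ∀ i, (v i).im • A i = (2 * Complex.I)⁻¹ • (v i • A i - star (v i) • A i) := by
      intro i
      rw [← sub_smul, smul_smul, ← Complex.coe_smul, Complex.im_eq_sub_conj, Complex.star_def]
      congr 1
      ring
    simp only [h, ← Finset.smul_sum, Finset.sum_sub_distrib, hv, hstar, sub_zero, smul_zero]
  exact fun i => Complex.ext (hA.eq_zero_of_sum_smul_eq_zero hA0 _ hre i)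
    (hA.eq_zero_of_sum_smul_eq_zero hA0 _ him i)

/-- A rank-one observable with Gram matrix `G` is extremal iff the matrix with entries
`|G i j|²` is invertible. -/
theorem stmt_11 {N h : ℕ} (e : Fin N → Fin h → ℂ)
    (he0 : ∀ i, e i ≠ 0)
    (he : ∑ i, vecMulVec (e i) (star (e i)) = 1)
    (G : Matrix (Fin N) (Fin N) ℂ)
    (hG : ∀ i j, G i j = star (e i) ⬝ᵥ e j) :
    IsExtremalObservable (fun i => vecMulVec (e i) (star (e i))) ↔
      IsUnit (Matrix.of (fun i j : Fin N => G i j * star (G i j))) := by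
  rw [isUnit_normSq_gram_iff e G hG]
  refine ⟨fun hA => hA.linearIndependent fun i => ?_,
    isExtremalObservable_of_linearIndependent e he0 he⟩
  exact vecMulVec_ne_zero (he0 i) (star_ne_zero.2 (he0 i))
end

section
/- Let A = (A_1,…,A_N) be an N-valued observable in ℂ^{h_1} and let B = (P_1,…,P_N) be a sharp N-valued observable in ℂ^{h_2}, i.e. each P_i is an orthogonal projection and ∑_i P_i = 1. Then the direct sum A ⊕ B = (A_1 ⊕ P_1,…,A_N ⊕ P_N), an N-valued observable in ℂ^{h_1} ⊕ ℂ^{h_2}, is extremal if and only if A is extremal. -/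
open Matrix
open scoped ComplexOrder

open scoped MatrixOrder in
/-- A positive semidefinite matrix whose compression by `R` vanishes annihilates the range
of `R`. -/
theorem Matrix.PosSemidef.mul_eq_zero_of_conjTranspose_mul_mul_eq_zero {m n : Type*} [Fintype m]
    [Fintype n] {C : Matrix m m ℂ} (hC : C.PosSemidef) {R : Matrix m n ℂ}
    (h : Rᴴ * C * R = 0) : C * R = 0 := by
  classical
  obtain ⟨S, rfl⟩ := CStarAlgebra.nonneg_iff_eq_star_mul_self.mp hC.nonneg
  have hS : S * R = 0 := by
    rw [← conjTranspose_mul_self_eq_zero, conjTranspose_mul, ← h, star_eq_conjTranspose]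
    simp only [Matrix.mul_assoc]
  rw [Matrix.mul_assoc, hS, Matrix.mul_zero]

open scoped MatrixOrder in
/-- If a positive combination of positive semidefinite matrices has vanishing compression
by `R`, then each of them annihilates the range of `R`. -/
theorem Matrix.PosSemidef.mul_eq_zero_of_combination {m n : Type*} [Fintype m] [Fintype n]
    {C D : Matrix m m ℂ} (hC : C.PosSemidef) (hD : D.PosSemidef) {a b : ℝ} (ha : 0 < a)
    (hb : 0 < b) {R : Matrix m n ℂ} (h : Rᴴ * (a • C + b • D) * R = 0) : C * R = 0 := by
  have hCR := (hC.smul ha.le).conjTranspose_mul_mul_same R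
  have hDR := (hD.smul hb.le).conjTranspose_mul_mul_same R
  rw [Matrix.mul_add, Matrix.add_mul] at h
  have hzero := ((add_eq_zero_iff_of_nonneg hCR.nonneg hDR.nonneg).mp h).1
  refine hC.mul_eq_zero_of_conjTranspose_mul_mul_eq_zero ?_
  rw [Matrix.mul_smul, Matrix.smul_mul] at hzero
  exact (smul_eq_zero.mp hzero).resolve_left ha.ne'

open scoped MatrixOrder in
/-- Distinct components of a sharp observable are orthogonal. -/
theorem IsObservable.mul_eq_zero_of_sharp {ι n : Type*} [Fintype ι] [Fintype n] [DecidableEq n]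
    {P : ι → Matrix n n ℂ} (hP : IsObservable P)
    (hsharp : ∀ i, (P i).IsHermitian ∧ P i * P i = P i) {i j : ι} (hij : i ≠ j) :
    P i * P j = 0 := by
  classical
  have hsum : ∑ k ∈ Finset.univ.erase j, P j * P k * P j = 0 := by
    have h : ∑ k, P j * P k * P j = P j := by
      rw [← Finset.sum_mul, ← Finset.mul_sum, hP.2, mul_one, (hsharp j).2]
    rw [← Finset.add_sum_erase _ _ (Finset.mem_univ j), (hsharp j).2, (hsharp j).2] at h
    exact left_eq_add.mp h.symm
  have hnonneg : ∀ k ∈ Finset.univ.erase j, 0 ≤ P j * P k * P j := fun k _ => by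
    have h := ((hP.1 k).conjTranspose_mul_mul_same (P j)).nonneg
    rwa [(hsharp j).1.eq] at h
  refine (hP.1 i).mul_eq_zero_of_conjTranspose_mul_mul_eq_zero ?_
  rw [(hsharp j).1.eq]
  exact (Finset.sum_eq_zero_iff_of_nonneg hnonneg).mp hsum i
    (Finset.mem_erase.mpr ⟨hij, Finset.mem_univ i⟩)

/-- If an observable `C` is part of a positive combination whose compression by `J` is a sharp
observable `P`, then `J` intertwines `C` and `P`. -/
theorem IsObservable.mul_eq_mul_of_sharp_compression {ι m n : Type*} [Fintype ι] [Fintype m]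
    [DecidableEq m] [Fintype n] [DecidableEq n] {C D : ι → Matrix m m ℂ} {P : ι → Matrix n n ℂ}
    (hC : IsObservable C) (hD : IsObservable D) (hP : IsObservable P)
    (hsharp : ∀ i, (P i).IsHermitian ∧ P i * P i = P i) {a b : ℝ} (ha : 0 < a) (hb : 0 < b)
    {J : Matrix m n ℂ} (h : ∀ i, Jᴴ * (a • C i + b • D i) * J = P i) (i : ι) :
    C i * J = J * P i := by
  have hCJ : ∀ k, C k * J = C k * J * P k := fun k => by
    have hker : C k * (J * (1 - P k)) = 0 := by
      refine (hC.1 k).mul_eq_zero_of_combination (hD.1 k) ha hb ?_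
      calc (J * (1 - P k))ᴴ * (a • C k + b • D k) * (J * (1 - P k))
          = (1 - P k)ᴴ * (Jᴴ * (a • C k + b • D k) * J) * (1 - P k) := by
            simp only [conjTranspose_mul, Matrix.mul_assoc]
        _ = 0 := by
            rw [h, Matrix.mul_assoc, mul_sub, mul_one, (hsharp k).2, sub_self, Matrix.mul_zero]
    rwa [← Matrix.mul_assoc, Matrix.mul_sub, Matrix.mul_one, sub_eq_zero] at hker
  calc C i * J = C i * J * P i := hCJ i
    _ = ∑ k, C k * J * P i := by
      symm
      refine Finset.sum_eq_single i (fun k _ hk => ?_) (fun hi => absurd (Finset.mem_univ i) hi)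
      rw [hCJ k, Matrix.mul_assoc, hP.mul_eq_zero_of_sharp hsharp hk, Matrix.mul_zero]
    _ = J * P i := by
      rw [← Matrix.sum_mul, ← Matrix.sum_mul, hC.2, Matrix.one_mul]

/-- The direct sum of two positive semidefinite matrices is positive semidefinite. -/
theorem Matrix.PosSemidef.fromBlocks_zero {m n : Type*} [Fintype m] [Fintype n]
    {X : Matrix m m ℂ} {Y : Matrix n n ℂ} (hX : X.PosSemidef) (hY : Y.PosSemidef) :
    (fromBlocks X 0 0 Y).PosSemidef := by
  classical
  have h := (hX.conjTranspose_mul_mul_same (fromCols (1 : Matrix m m ℂ) (0 : Matrix m n ℂ))).add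
    (hY.conjTranspose_mul_mul_same (fromCols (0 : Matrix n m ℂ) (1 : Matrix n n ℂ)))
  convert h using 1
  ext (i | i) (j | j) <;>
    simp [conjTranspose_fromCols_eq_fromRows_conjTranspose, fromRows_mul]

/-- The direct sum of two observables is an observable. -/
theorem IsObservable.fromBlocks {ι m n : Type*} [Fintype ι] [Fintype m] [DecidableEq m]
    [Fintype n] [DecidableEq n] {A : ι → Matrix m m ℂ} {B : ι → Matrix n n ℂ}
    (hA : IsObservable A) (hB : IsObservable B) :
    IsObservable (fun i => Matrix.fromBlocks (A i) 0 0 (B i)) := by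
  refine ⟨fun i => (hA.1 i).fromBlocks_zero (hB.1 i), ?_⟩
  rw [← fromBlocks_one, ← hA.2, ← hB.2]
  ext (i | i) (j | j) <;> simp [Matrix.sum_apply]

/-- The upper left corner of an observable is an observable. -/
theorem IsObservable.toBlocks₁₁ {ι m n : Type*} [Fintype ι] [Fintype m] [DecidableEq m]
    [Fintype n] [DecidableEq n] {C : ι → Matrix (m ⊕ n) (m ⊕ n) ℂ} (hC : IsObservable C) :
    IsObservable (fun i => (C i).toBlocks₁₁) := by
  refine ⟨fun i => (hC.1 i).submatrix Sum.inl, ?_⟩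
  have h := congrArg Matrix.toBlocks₁₁ hC.2
  rw [← fromBlocks_one, toBlocks_fromBlocks₁₁] at h
  rw [← h]
  ext i j
  simp [Matrix.sum_apply, Matrix.toBlocks₁₁]

/-- A Hermitian block matrix whose second block column is that of `0 ⊕ P` is the direct sum of
its upper left corner and `P`. -/
theorem Matrix.IsHermitian.eq_fromBlocks_of_mul_fromRows {m n : Type*} [Fintype m] [Fintype n]
    [DecidableEq n] {C : Matrix (m ⊕ n) (m ⊕ n) ℂ} (hC : C.IsHermitian) {P : Matrix n n ℂ}
    (h : C * fromRows (0 : Matrix m n ℂ) (1 : Matrix n n ℂ) =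
      fromRows (0 : Matrix m n ℂ) (1 : Matrix n n ℂ) * P) :
    C = Matrix.fromBlocks C.toBlocks₁₁ 0 0 P := by
  rw [← fromBlocks_toBlocks C, ← fromCols_fromRows_eq_fromBlocks, fromCols_mul_fromRows,
    Matrix.mul_zero, zero_add, Matrix.mul_one, fromRows_mul, Matrix.zero_mul, Matrix.one_mul] at h
  obtain ⟨h₁₂, h₂₂⟩ := fromRows_inj.eq_iff.mp h
  have h₂₁ : C.toBlocks₂₁ = 0 := by
    ext i j
    have hij := congrFun (congrFun h₁₂ j) i
    rw [toBlocks₁₂, of_apply, zero_apply] at hij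
    rw [toBlocks₂₁, of_apply, ← hC.apply, hij, star_zero, zero_apply]
  conv_lhs => rw [← fromBlocks_toBlocks C, h₁₂, h₂₁, h₂₂]

/-- The direct sum of an arbitrary observable with a sharp observable is extremal iff the
first observable is extremal. -/
theorem stmt_12 {N h₁ h₂ : ℕ} (A : Fin N → Matrix (Fin h₁) (Fin h₁) ℂ)
    (B : Fin N → Matrix (Fin h₂) (Fin h₂) ℂ)
    (hA : IsObservable A) (hB : IsObservable B)
    (hBsharp : ∀ i, (B i).IsHermitian ∧ B i * B i = B i) :
    IsExtremalObservable (fun i => Matrix.fromBlocks (A i) 0 0 (B i)) ↔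
      IsExtremalObservable A := by
  constructor
  · rintro ⟨-, hext⟩
    refine ⟨hA, fun C hC D hD ⟨a, b, ha, hb, hab, hcomb⟩ => ?_⟩
    have heq := hext (hC.fromBlocks hB) (hD.fromBlocks hB) ⟨a, b, ha, hb, hab, ?_⟩
    · funext i
      exact (fromBlocks_inj.mp (congrFun heq i)).1
    · funext i
      have hi : a • C i + b • D i = A i := congrFun hcomb i
      simp [fromBlocks_smul, fromBlocks_add, hi, ← add_smul, hab]
  · rintro ⟨-, hext⟩
    refine ⟨hA.fromBlocks hB, fun C hC D hD ⟨a, b, ha, hb, hab, hcomb⟩ => ?_⟩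
    have hcomb' : ∀ i, a • C i + b • D i = fromBlocks (A i) 0 0 (B i) := congrFun hcomb
    have hCB : ∀ i, C i = fromBlocks (C i).toBlocks₁₁ 0 0 (B i) := fun i => by
      refine Matrix.IsHermitian.eq_fromBlocks_of_mul_fromRows (hC.1 i).isHermitian
        (hC.mul_eq_mul_of_sharp_compression hD hB hBsharp ha hb (fun k => ?_) i)
      rw [hcomb', conjTranspose_fromRows_eq_fromCols_conjTranspose,
        ← fromCols_fromRows_eq_fromBlocks, Matrix.mul_assoc, fromCols_mul_fromRows,
        Matrix.mul_zero, zero_add, Matrix.mul_one, fromCols_mul_fromRows]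
      simp
    have hCA := hext hC.toBlocks₁₁ hD.toBlocks₁₁ ⟨a, b, ha, hb, hab, ?_⟩
    · funext i
      rw [hCB i, congrFun hCA i]
    · funext i
      exact congrArg Matrix.toBlocks₁₁ (hcomb' i)
end

section
/- Let A = (A_1,…,A_{N_1}) be an N_1-valued observable in ℂ^{h_1} and B = (B_1,…,B_{N_2}) an N_2-valued observable in ℂ^{h_2}. Define the tensor product A ⊗ B as the (N_1·N_2)-valued observable in ℂ^{h_1} ⊗ ℂ^{h_2} with components A_i ⊗ B_j (Kronecker products) for (i,j) ∈ {1,…,N_1} × {1,…,N_2}. If A and B are both extremal, then A ⊗ B is extremal. -/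
open Matrix
open scoped ComplexOrder

namespace Matrix

/-- Every square matrix over a field has a generalized inverse. -/
theorem exists_mul_mul_self_eq {K n : Type*} [Field K] [Fintype n] [DecidableEq n]
    (A : Matrix n n K) : ∃ G : Matrix n n K, A * G * A = A := by
  obtain ⟨g, hg⟩ := (toLin' A).rangeRestrict.exists_rightInverse_of_surjective
    (LinearMap.range_rangeRestrict _)
  obtain ⟨G, hG⟩ := LinearMap.exists_extend g
  refine ⟨LinearMap.toMatrix' G, toLin'.injective (LinearMap.ext fun v => ?_)⟩
  have h₁ := LinearMap.congr_fun hG ((toLin' A).rangeRestrict v)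
  have h₂ := congrArg Subtype.val (LinearMap.congr_fun hg ((toLin' A).rangeRestrict v))
  simp only [LinearMap.comp_apply, Submodule.subtype_apply, LinearMap.codRestrict_apply,
    LinearMap.rangeRestrict, LinearMap.id_apply] at h₁ h₂
  rw [toLin'_mul, toLin'_mul, toLin'_toMatrix', LinearMap.comp_apply, LinearMap.comp_apply, h₁, h₂]

/-- A Hermitian matrix vanishing on the kernel of a Hermitian matrix `A` has the form `A X A`. -/
theorem IsHermitian.exists_eq_mul_mul {n : Type*} [Fintype n] [DecidableEq n]
    {A D : Matrix n n ℂ} (hA : A.IsHermitian) (hD : D.IsHermitian)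
    (hker : ∀ v, A *ᵥ v = 0 → D *ᵥ v = 0) : ∃ X, D = A * X * A := by
  obtain ⟨G, hG⟩ := exists_mul_mul_self_eq A
  have hDGA : D * (1 - G * A) = 0 := by
    refine toLin'.injective (LinearMap.ext fun v => ?_)
    have : A *ᵥ ((1 - G * A) *ᵥ v) = 0 := by
      rw [mulVec_mulVec, mul_sub, mul_one, ← mul_assoc, hG, sub_self, zero_mulVec]
    simpa only [toLin'_apply, mulVec_mulVec, map_zero, LinearMap.zero_apply] using hker _ this
  have h₁ : D = D * G * A := by
    rw [mul_sub, mul_one, sub_eq_zero, ← mul_assoc] at hDGA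
    exact hDGA
  have h₂ : D = A * Gᴴ * D := by
    have := congrArg (·ᴴ) h₁
    rwa [conjTranspose_mul, conjTranspose_mul, hA.eq, hD.eq, ← mul_assoc] at this
  refine ⟨Gᴴ * D * G, ?_⟩
  calc D = A * Gᴴ * (D * G * A) := by rw [← h₁, ← h₂]
    _ = A * (Gᴴ * D * G) * A := by simp only [mul_assoc]

section

open scoped MatrixOrder Matrix.Norms.L2Operator

/-- Small multiples of a Hermitian matrix are dominated by the identity. -/
theorem IsHermitian.exists_pos_posSemidef_one_add_smul {n : Type*} [Fintype n] [DecidableEq n]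
    {X : Matrix n n ℂ} (hX : X.IsHermitian) :
    ∃ ε : ℝ, 0 < ε ∧ ∀ t : ℝ, |t| ≤ ε → (1 + t • X).PosSemidef := by
  refine ⟨1 / (‖X‖ + 1), by positivity, fun t ht => ?_⟩
  have htX : IsSelfAdjoint (t • X) := IsSelfAdjoint.smul (IsSelfAdjoint.all t) hX
  have hnorm : ‖t • X‖ ≤ 1 := by
    rw [norm_smul, Real.norm_eq_abs]
    calc |t| * ‖X‖ ≤ 1 / (‖X‖ + 1) * (‖X‖ + 1) := by gcongr; linarith
      _ = 1 := by field_simp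
  have h := htX.neg_algebraMap_norm_le_self
  have h₁ : algebraMap ℝ (Matrix n n ℂ) ‖t • X‖ ≤ algebraMap ℝ (Matrix n n ℂ) 1 :=
    algebraMap_mono _ hnorm
  rw [map_one] at h₁
  rw [← nonneg_iff_posSemidef]
  have h₂ := (neg_le_neg h₁).trans h
  rwa [neg_le_iff_add_nonneg'] at h₂

end

/-- Adding a small multiple of `A X A` to a positive semidefinite `A` preserves positivity. -/
theorem PosSemidef.exists_pos_add_smul_mul_mul {n : Type*} [Fintype n] [DecidableEq n]
    {A X : Matrix n n ℂ} (hA : A.PosSemidef) (hX : X.IsHermitian) :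
    ∃ ε : ℝ, 0 < ε ∧ ∀ t : ℝ, |t| ≤ ε → (A + t • (A * X * A)).PosSemidef := by
  obtain ⟨K, rfl⟩ : ∃ K : Matrix n n ℂ, A = Kᴴ * K := by
    open scoped MatrixOrder in
    exact CStarAlgebra.nonneg_iff_eq_star_mul_self.mp hA.nonneg
  obtain ⟨ε, hε, h⟩ := (isHermitian_mul_mul_conjTranspose K hX).exists_pos_posSemidef_one_add_smul
  refine ⟨ε, hε, fun t ht => ?_⟩
  have := (h t ht).conjTranspose_mul_mul_same K
  simpa only [mul_add, add_mul, mul_one, mul_smul_comm, smul_mul_assoc, mul_assoc] using this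

end Matrix

section Observable

variable {ι n : Type*} [Fintype ι] [Fintype n] [DecidableEq n]

theorem IsExtremalObservable.mul_mul_eq_zero_of_isHermitian {A X : ι → Matrix n n ℂ}
    (hA : IsExtremalObservable A) (hX : ∀ i, (X i).IsHermitian)
    (hsum : ∑ i, A i * X i * A i = 0) (i : ι) : A i * X i * A i = 0 := by
  obtain ⟨⟨hpos, hone⟩, hext⟩ := hA
  choose ε hε h using fun i => (hpos i).exists_pos_add_smul_mul_mul (hX i)
  obtain ⟨δ, hδ, hδε⟩ : ∃ δ : ℝ, 0 < δ ∧ ∀ i, δ ≤ ε i := by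
    have : Nonempty ι := ⟨i⟩
    obtain ⟨j, hj⟩ := Finite.exists_min ε
    exact ⟨ε j, hε j, hj⟩
  have hobs : ∀ t : ℝ, |t| ≤ δ → IsObservable fun i => A i + t • (A i * X i * A i) := fun t ht =>
    ⟨fun i => h i t (ht.trans (hδε i)), by
      rw [Finset.sum_add_distrib, ← Finset.smul_sum, hsum, hone, smul_zero, add_zero]⟩
  have key := hext (hobs δ (abs_of_pos hδ).le) (hobs (-δ) (by rw [abs_neg, abs_of_pos hδ]))
    ⟨1 / 2, 1 / 2, by norm_num, by norm_num, by norm_num, by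
      ext1 i
      simp only [Pi.add_apply, Pi.smul_apply]
      module⟩
  have := congrFun key i
  simpa [hδ.ne'] using this

/-- For an extremal observable `A`, the subspaces `A i * M * A i` are independent. -/
theorem IsExtremalObservable.mul_mul_eq_zero {A X : ι → Matrix n n ℂ}
    (hA : IsExtremalObservable A) (hsum : ∑ i, A i * X i * A i = 0) (i : ι) :
    A i * X i * A i = 0 := by
  have hH : ∀ i, (A i)ᴴ = A i := fun i => (hA.1.1 i).1
  have hsum' : ∑ i, A i * (X i)ᴴ * A i = 0 := by
    have := congrArg (·ᴴ) hsum
    simpa [conjTranspose_sum, conjTranspose_mul, hH, mul_assoc] using this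
  have hre := hA.mul_mul_eq_zero_of_isHermitian (X := fun i => X i + (X i)ᴴ)
    (fun i => isHermitian_add_transpose_self _)
    (by simp [mul_add, add_mul, Finset.sum_add_distrib, hsum, hsum']) i
  have him := hA.mul_mul_eq_zero_of_isHermitian (X := fun i => Complex.I • (X i - (X i)ᴴ))
    (fun i => by
      simp only [IsHermitian, conjTranspose_smul, conjTranspose_sub, conjTranspose_conjTranspose,
        Complex.star_def, Complex.conj_I]
      module)
    (by simp [mul_sub, sub_mul, ← Finset.smul_sum, Finset.sum_sub_distrib, hsum, hsum']) i
  simp only [mul_add, add_mul] at hre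
  simp only [mul_smul_comm, smul_mul_assoc, smul_eq_zero, Complex.I_ne_zero, false_or, mul_sub,
    sub_mul] at him
  rw [sub_eq_zero] at him
  rw [← him, ← two_smul ℂ] at hre
  simpa using hre

/-- An observable `A` for which the subspaces `A i * M * A i` are independent is extremal. -/
theorem IsObservable.isExtremalObservable {A : ι → Matrix n n ℂ} (hA : IsObservable A)
    (h : ∀ X : ι → Matrix n n ℂ, ∑ i, A i * X i * A i = 0 → ∀ i, A i * X i * A i = 0) :
    IsExtremalObservable A := by
  refine ⟨hA, ?_⟩
  rintro C hC C' hC' ⟨a, b, ha, hb, -, rfl⟩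
  set A := a • C + b • C' with hAdef
  have hker : ∀ i v, A i *ᵥ v = 0 → (C i - A i) *ᵥ v = 0 := by
    intro i v hv
    have hsum : a • (star v ⬝ᵥ C i *ᵥ v) + b • (star v ⬝ᵥ C' i *ᵥ v) = 0 := by
      have := congrArg (star v ⬝ᵥ ·) hv
      simpa [hAdef, add_mulVec, smul_mulVec, dotProduct_add, dotProduct_smul] using this
    have h₁ := smul_nonneg ha.le ((hC.1 i).dotProduct_mulVec_nonneg v)
    have h₂ := smul_nonneg hb.le ((hC'.1 i).dotProduct_mulVec_nonneg v)
    have h₃ := ((add_eq_zero_iff_of_nonneg h₁ h₂).mp hsum).1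
    rw [smul_eq_zero_iff_right ha.ne', (hC.1 i).dotProduct_mulVec_zero_iff] at h₃
    rw [sub_mulVec, h₃, hv, sub_zero]
  choose X hX using fun i => (hA.1 i).1.exists_eq_mul_mul ((hC.1 i).1.sub (hA.1 i).1) (hker i)
  have hzero := h X (by simp only [← hX, Finset.sum_sub_distrib, hC.2, hA.2, sub_self])
  ext1 i
  rw [← sub_eq_zero, hX, hzero]

end Observable

section Kronecker

open scoped Kronecker

variable {ι κ m n : Type*} [Fintype ι] [Fintype κ] [Fintype m] [Fintype n]

theorem IsObservable.kronecker [DecidableEq m] [DecidableEq n] {A : ι → Matrix m m ℂ}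
    {B : κ → Matrix n n ℂ} (hA : IsObservable A) (hB : IsObservable B) :
    IsObservable fun p : ι × κ => A p.1 ⊗ₖ B p.2 := by
  refine ⟨fun p => (hA.1 p.1).kronecker (hB.1 p.2), ?_⟩
  rw [← one_kronecker_one, ← hA.2, ← hB.2, Fintype.sum_prod_type]
  ext ⟨a, b⟩ ⟨c, d⟩
  simp [Matrix.sum_apply, Finset.sum_mul_sum]

namespace Matrix

/-- A block of `(A ⊗ B) X (A ⊗ B)` with fixed second indices lies in `A M A`. -/
theorem kronecker_mul_mul_kronecker_submatrix_left (A : Matrix m m ℂ) (B : Matrix n n ℂ)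
    (X : Matrix (m × n) (m × n) ℂ) (a b : n) :
    ((A ⊗ₖ B) * X * (A ⊗ₖ B)).submatrix (·, a) (·, b) =
      A * (of fun k l => ∑ c, ∑ d, B a c * X (k, c) (l, d) * B d b) * A := by
  ext k l
  simp only [submatrix_apply, mul_apply, kroneckerMap_apply, of_apply, Fintype.sum_prod_type,
    Finset.sum_mul, Finset.mul_sum]
  refine Finset.sum_congr rfl fun x _ => ?_
  rw [Finset.sum_comm]
  refine Finset.sum_congr rfl fun y _ => ?_
  rw [Finset.sum_comm]
  exact Finset.sum_congr rfl fun _ _ => Finset.sum_congr rfl fun _ _ => by ring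

/-- A block of `(A ⊗ B) X (A ⊗ B)` with fixed first indices lies in `B M B`. -/
theorem kronecker_mul_mul_kronecker_submatrix_right (A : Matrix m m ℂ) (B : Matrix n n ℂ)
    (X : Matrix (m × n) (m × n) ℂ) (a b : m) :
    ((A ⊗ₖ B) * X * (A ⊗ₖ B)).submatrix (a, ·) (b, ·) =
      B * (of fun k l => ∑ c, ∑ d, A a c * X (c, k) (d, l) * A d b) * B := by
  ext k l
  simp only [submatrix_apply, mul_apply, kroneckerMap_apply, of_apply, Fintype.sum_prod_type,
    Finset.sum_mul, Finset.mul_sum]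
  rw [Finset.sum_comm]
  refine Finset.sum_congr rfl fun x _ => ?_
  rw [Finset.sum_comm, Finset.sum_comm (γ := n)]
  refine Finset.sum_congr rfl fun y _ => ?_
  rw [Finset.sum_comm]
  exact Finset.sum_congr rfl fun _ _ => Finset.sum_congr rfl fun _ _ => by ring

end Matrix

theorem IsExtremalObservable.kronecker [DecidableEq m] [DecidableEq n] {A : ι → Matrix m m ℂ}
    {B : κ → Matrix n n ℂ} (hA : IsExtremalObservable A) (hB : IsExtremalObservable B) :
    IsExtremalObservable fun p : ι × κ => A p.1 ⊗ₖ B p.2 := by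
  refine (IsObservable.kronecker hA.1 hB.1).isExtremalObservable fun X hX => ?_
  set D : ι → κ → Matrix (m × n) (m × n) ℂ :=
    fun i j => (A i ⊗ₖ B j) * X (i, j) * (A i ⊗ₖ B j) with hD
  have hsum : ∑ i, ∑ j, D i j = 0 := by rw [← hX, Fintype.sum_prod_type]
  have hleft : ∀ i, ∑ j, D i j = 0 := by
    intro i
    ext ⟨k, a⟩ ⟨l, b⟩
    have hblock : ∀ i, (∑ j, D i j).submatrix (·, a) (·, b) = A i * (∑ j, of fun k l =>
        ∑ c, ∑ d, B j a c * X (i, j) (k, c) (l, d) * B j d b) * A i := by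
      intro i
      rw [Finset.mul_sum, Finset.sum_mul]
      simp only [← kronecker_mul_mul_kronecker_submatrix_left]
      ext
      simp [Matrix.sum_apply, hD]
    have hblocks : ∑ i, (∑ j, D i j).submatrix (·, a) (·, b) = 0 := by
      ext k l
      simpa [Matrix.sum_apply] using congrFun₂ hsum (k, a) (l, b)
    simp only [hblock] at hblocks
    have := hA.mul_mul_eq_zero hblocks i
    rw [← hblock] at this
    exact congrFun₂ this k l
  rintro ⟨i, j⟩
  ext ⟨a, k⟩ ⟨b, l⟩
  have hblock := fun j => kronecker_mul_mul_kronecker_submatrix_right (A i) (B j) (X (i, j)) a b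
  have hblocks : ∑ j, (D i j).submatrix (a, ·) (b, ·) = 0 := by
    ext k l
    simpa [Matrix.sum_apply] using congrFun₂ (hleft i) (a, k) (b, l)
  simp only [hD, hblock] at hblocks
  have := hB.mul_mul_eq_zero hblocks j
  rw [← hblock] at this
  exact congrFun₂ this k l

end Kronecker

/-- The tensor (Kronecker) product of two extremal observables is extremal. -/
theorem stmt_17 {N₁ N₂ h₁ h₂ : ℕ}
    (A : Fin N₁ → Matrix (Fin h₁) (Fin h₁) ℂ)
    (B : Fin N₂ → Matrix (Fin h₂) (Fin h₂) ℂ)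
    (hA : IsObservable A) (hB : IsObservable B)
    (hAex : IsExtremalObservable A) (hBex : IsExtremalObservable B) :
    IsExtremalObservable
      (fun p : Fin N₁ × Fin N₂ => Matrix.kroneckerMap (· * ·) (A p.1) (B p.2)) :=
  hAex.kronecker hBex
end

section
/- Let A = (A_1,…,A_N) be an extremal N-valued observable in ℂ^h, fix an index n, and suppose A_n = B + α P where α > 0, P is a rank-one orthogonal projection satisfying A_n P = P A_n = α P, and B = A_n − α P is positive semidefinite. Then the (N+1)-valued observable A' obtained from A by replacing the component A_n with the two components B and α P (an elementary partial resolution of A) is extremal. -/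
open Matrix
open scoped ComplexOrder

/-- If a positive combination of positive semidefinite matrices annihilates `Q`, then so does
its first term. -/
theorem Matrix.PosSemidef.mul_eq_zero_of_add_mul_eq_zero {n m : Type*} [Fintype n] [Fintype m]
    {X Y : Matrix n n ℂ} (hX : X.PosSemidef) (hY : Y.PosSemidef) {a b : ℝ} (ha : 0 < a)
    (hb : 0 < b) {Q : Matrix n m ℂ} (h : (a • X + b • Y) * Q = 0) : X * Q = 0 := by
  refine Matrix.ext_iff_mulVec.mpr fun v => ?_
  rw [← mulVec_mulVec, zero_mulVec]
  have hw : a • (star (Q *ᵥ v) ⬝ᵥ X *ᵥ (Q *ᵥ v)) + b • (star (Q *ᵥ v) ⬝ᵥ Y *ᵥ (Q *ᵥ v)) = 0 := by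
    rw [← dotProduct_smul, ← dotProduct_smul, ← dotProduct_add, ← smul_mulVec, ← smul_mulVec,
      ← add_mulVec, mulVec_mulVec, h, zero_mulVec, dotProduct_zero]
  have hx := (add_eq_zero_iff_of_nonneg
    (smul_nonneg ha.le (hX.dotProduct_mulVec_nonneg _))
    (smul_nonneg hb.le (hY.dotProduct_mulVec_nonneg _))).mp hw
  exact (hX.dotProduct_mulVec_zero_iff _).mp ((smul_eq_zero.mp hx.1).resolve_left (ne_of_gt ha))

/-- Merging the last outcome of an observable into the outcome `k` gives an observable. -/
theorem IsObservable.merge_last {N : ℕ} {n : Type*} [Fintype n] [DecidableEq n]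
    {X : Fin (N + 1) → Matrix n n ℂ} (hX : IsObservable X) (k : Fin N) :
    IsObservable (fun i => X i.castSucc + if i = k then X (Fin.last N) else 0) := by
  refine ⟨fun i => (hX.1 _).add ?_, ?_⟩
  · split_ifs
    exacts [hX.1 _, PosSemidef.zero]
  · rw [Finset.sum_add_distrib, Finset.sum_ite_eq' Finset.univ k, if_pos (Finset.mem_univ k),
      ← Fin.sum_univ_castSucc, hX.2]

/-- An elementary partial resolution of an extremal observable is extremal: if `α P` is a
rank-one spectral piece of the component `A n`, then replacing `A n` by the pair
`(A n - α P, α P)` yields an extremal `(N+1)`-valued observable. -/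
theorem stmt_18 {N h : ℕ} (A : Fin N → Matrix (Fin h) (Fin h) ℂ)
    (hA : IsObservable A) (hAex : IsExtremalObservable A)
    (n : Fin N) (α : ℝ) (hα : 0 < α) (P : Matrix (Fin h) (Fin h) ℂ)
    (hPh : P.IsHermitian) (hP2 : P * P = P) (hPrank : P.rank = 1)
    (hAP : A n * P = (α : ℂ) • P) (hPA : P * A n = (α : ℂ) • P)
    (hB : (A n - (α : ℂ) • P).PosSemidef) :
    IsExtremalObservable
      (Fin.snoc (Function.update A n (A n - (α : ℂ) • P)) ((α : ℂ) • P)) := by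
  have hP : P.PosSemidef := by
    have := posSemidef_conjTranspose_mul_self P
    rwa [hPh.eq, hP2] at this
  refine ⟨⟨fun i => ?_, ?_⟩, ?_⟩
  · refine Fin.lastCases ?_ (fun i => ?_) i
    · rw [Fin.snoc_last]
      exact hP.smul (by exact_mod_cast hα.le)
    · rw [Fin.snoc_castSucc]
      rcases eq_or_ne i n with rfl | hi
      · rwa [Function.update_self]
      · rw [Function.update_of_ne hi]
        exact hA.1 i
  · rw [Fin.sum_univ_castSucc]
    simp only [Fin.snoc_castSucc, Fin.snoc_last]
    rw [Finset.sum_update_of_mem (Finset.mem_univ n), ← hA.2,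
      Finset.sum_eq_add_sum_sdiff_singleton_of_mem (Finset.mem_univ n) A]
    abel
  · rintro X hX Y hY ⟨a, b, ha, hb, hab, hXY⟩
    have hcast (i : Fin N) : a • X i.castSucc + b • Y i.castSucc =
        Function.update A n (A n - (α : ℂ) • P) i := by
      simpa using congrFun hXY i.castSucc
    have hlast : a • X (Fin.last N) + b • Y (Fin.last N) = (α : ℂ) • P := by
      simpa using congrFun hXY (Fin.last N)
    have hmerge := hAex.2 (hX.merge_last n) (hY.merge_last n) ⟨a, b, ha, hb, hab, by
      funext i
      simp only [Pi.add_apply, Pi.smul_apply, smul_add]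
      rw [add_add_add_comm, hcast]
      rcases eq_or_ne i n with rfl | hi
      · simp [hlast]
      · simp [hi]⟩
    have hsum : X n.castSucc + X (Fin.last N) = A n := by
      simpa using congrFun hmerge n
    have hXnP : X n.castSucc * P = 0 :=
      (hX.1 _).mul_eq_zero_of_add_mul_eq_zero (hY.1 _) ha hb (by
        rw [hcast, Function.update_self, sub_mul, hAP, smul_mul, hP2, sub_self])
    have hXlastQ : X (Fin.last N) * (1 - P) = 0 :=
      (hX.1 _).mul_eq_zero_of_add_mul_eq_zero (hY.1 _) ha hb (by
        rw [hlast, smul_mul, mul_sub, mul_one, hP2, sub_self, smul_zero])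
    have hXlast : X (Fin.last N) = (α : ℂ) • P := by
      rw [mul_sub, mul_one, sub_eq_zero] at hXlastQ
      rw [hXlastQ, ← hAP, ← hsum, add_mul, hXnP, zero_add]
    funext i
    refine Fin.lastCases ?_ (fun i => ?_) i
    · rw [Fin.snoc_last, hXlast]
    · rw [Fin.snoc_castSucc]
      rcases eq_or_ne i n with rfl | hi
      · rw [Function.update_self, ← hsum, hXlast, add_sub_cancel_right]
      · rw [Function.update_of_ne hi]
        simpa [hi] using congrFun hmerge i
end
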